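/- There exists a constant C > 0 such that for every k_F ≥ 1 and every k ∈ ℤ³ with |k| ≥ 2k_F, one has D₁(k, k_F) ≤ C k_F³ |k|^{−2}. -/

import Mathlib

open scoped BigOperators

/-- The Euclidean norm of a lattice point `k ∈ ℤ³`. -/
noncomputable def znorm (k : Fin 3 → ℤ) : ℝ := Real.sqrt (∑ i, ((k i : ℝ))^2)

/-- The lune set `L(k) = {p ∈ ℤ³ : |p| > k_F and |p − k| ≤ k_F}`. -/
def lune (kF : ℝ) (k : Fin 3 → ℤ) : Set (Fin 3 → ℤ) :=
  {p | kF < znorm p ∧ znorm (p - k) ≤ kF}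

/- The resolvent sum `D_α(k, k_F) = Σ_{p ∈ L(k)} (|p|² − |p − k|²)^{−α}`
(a finite sum, written as a `tsum` of the indicator; the power is a real power). -/
open Classical in
noncomputable def Dsum (α kF : ℝ) (k : Fin 3 → ℤ) : ℝ :=
  ∑' p : Fin 3 → ℤ,
    if p ∈ lune kF k then ((znorm p) ^ 2 - (znorm (p - k)) ^ 2) ^ (-α) else 0

lemma znorm_nonneg (k : Fin 3 → ℤ) : 0 ≤ znorm k := Real.sqrt_nonneg _

lemma znorm_sq (k : Fin 3 → ℤ) : znorm k ^ 2 = ∑ i, (k i : ℝ) ^ 2 :=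
  Real.sq_sqrt (Finset.sum_nonneg fun _ _ => sq_nonneg _)

lemma abs_coord_le_znorm (k : Fin 3 → ℤ) (i : Fin 3) : |(k i : ℝ)| ≤ znorm k := by
  refine abs_le_of_sq_le_sq ?_ (znorm_nonneg k)
  rw [znorm_sq]
  exact Finset.single_le_sum (f := fun i => (k i : ℝ) ^ 2) (fun _ _ => sq_nonneg _)
    (Finset.mem_univ i)

/-- The gap `|p|² - |p - k|²` equals `k · (2p - k)`. -/
lemma gap_eq (p k : Fin 3 → ℤ) :
    znorm p ^ 2 - znorm (p - k) ^ 2 = ∑ i, (k i : ℝ) * (2 * p i - k i) := by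
  rw [znorm_sq, znorm_sq, ← Finset.sum_sub_distrib]
  refine Finset.sum_congr rfl fun i _ => ?_
  simp only [Pi.sub_apply, Int.cast_sub]
  ring

lemma one_le_gap {kF : ℝ} {p k : Fin 3 → ℤ} (hp : p ∈ lune kF k) :
    1 ≤ znorm p ^ 2 - znorm (p - k) ^ 2 := by
  have hlt : znorm (p - k) < znorm p := hp.2.trans_lt hp.1
  have hpos : 0 < znorm p ^ 2 - znorm (p - k) ^ 2 := by
    nlinarith [znorm_nonneg (p - k)]
  rw [gap_eq] at hpos ⊢
  have hcast : ∑ i, (k i : ℝ) * (2 * p i - k i) = ((∑ i, k i * (2 * p i - k i) : ℤ) : ℝ) := by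
    push_cast; rfl
  rw [hcast] at hpos ⊢
  exact_mod_cast hpos

/-- The parallelogram-type bound `|2p - k|² ≤ 2 (|p|² - |p - k|²)` on the lune when `|k| ≥ 2 k_F`. -/
lemma sum_sq_le_gap {kF : ℝ} {p k : Fin 3 → ℤ} (hp : p ∈ lune kF k)
    (hk : 2 * kF ≤ znorm k) :
    ∑ i, (2 * (p i : ℝ) - k i) ^ 2 ≤ 2 * (znorm p ^ 2 - znorm (p - k) ^ 2) := by
  have h0 := znorm_nonneg (p - k)
  have h1 : 4 * znorm (p - k) ^ 2 ≤ znorm k ^ 2 := by nlinarith [hp.2]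
  have h2 : ∑ i, (2 * (p i : ℝ) - k i) ^ 2
      = 2 * znorm p ^ 2 + 2 * znorm (p - k) ^ 2 - znorm k ^ 2 := by
    simp only [znorm_sq, Fin.sum_univ_three, Pi.sub_apply, Int.cast_sub]
    ring
  linarith

lemma gap_eq_inner (p k : Fin 3 → ℤ) :
    znorm p ^ 2 - znorm (p - k) ^ 2
      = znorm k ^ 2 + 2 * ∑ i, (k i : ℝ) * ((p - k) i : ℤ) := by
  simp only [znorm_sq, Fin.sum_univ_three, Pi.sub_apply, Int.cast_sub]
  ring

lemma abs_inner_le (k q : Fin 3 → ℤ) : |∑ i, (k i : ℝ) * (q i : ℝ)| ≤ znorm k * znorm q := by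
  refine abs_le_of_sq_le_sq ?_ (mul_nonneg (znorm_nonneg k) (znorm_nonneg q))
  rw [mul_pow, znorm_sq, znorm_sq]
  exact Finset.sum_mul_sq_le_sq_mul_sq _ _ _

lemma sum_range_inv_sqrt_le {c v : ℝ} (hc : 1 ≤ c) (hv : 0 < v) (m : ℕ) :
    ∑ j ∈ Finset.range (m + 1), (√(c + v * j))⁻¹ ≤ 1 + 2 * √(c + v * m) / v := by
  induction m with
  | zero =>
    simp only [zero_add, Finset.sum_range_one, Nat.cast_zero, mul_zero, add_zero]
    have : (√c)⁻¹ ≤ 1 := inv_le_one_of_one_le₀ (Real.one_le_sqrt.mpr hc)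
    have : 0 ≤ 2 * √c / v := by positivity
    linarith
  | succ m ih =>
    rw [Finset.sum_range_succ]
    have hm : (0 : ℝ) ≤ v * m := by positivity
    set s := √(c + v * m)
    set t := √(c + v * ((m + 1 : ℕ) : ℝ))
    have hs : s ^ 2 = c + v * m := Real.sq_sqrt (by linarith)
    have ht : t ^ 2 = c + v * m + v := by
      rw [Real.sq_sqrt (by push_cast; linarith)]
      push_cast; ring
    have hs0 : 0 ≤ s := Real.sqrt_nonneg _
    have ht0 : 0 < t := Real.sqrt_pos.mpr (by push_cast; linarith)
    have hst : s ≤ t := by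
      apply Real.sqrt_le_sqrt
      push_cast; linarith
    have key : t⁻¹ ≤ 2 * t / v - 2 * s / v := by
      rw [← sub_div, inv_eq_one_div, div_le_div_iff₀ ht0 hv]
      nlinarith [mul_nonneg hs0 (sub_nonneg.mpr hst)]
    linarith

lemma sum_inv_sqrt_affine_le_of_pos {ι : Type*} (T : Finset ι) (φ : ι → ℤ)
    (hφ : Set.InjOn φ T) {u v M : ℝ} (hv : 0 < v)
    (h1 : ∀ x ∈ T, 1 ≤ u + v * φ x) (hM : ∀ x ∈ T, u + v * φ x ≤ M) :
    ∑ x ∈ T, (√(u + v * φ x))⁻¹ ≤ 1 + 2 * √M / v := by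
  rcases T.eq_empty_or_nonempty with rfl | hT
  · simp only [Finset.sum_empty]
    positivity
  obtain ⟨x₀, hx₀, hmin⟩ := T.exists_min_image φ hT
  obtain ⟨x₁, hx₁, hmax⟩ := T.exists_max_image φ hT
  have h01 := hmin x₁ hx₁
  set m := (φ x₁ - φ x₀).toNat
  have hm : (m : ℝ) = φ x₁ - φ x₀ := by
    have : (m : ℤ) = φ x₁ - φ x₀ := Int.toNat_of_nonneg (by omega)
    exact_mod_cast this
  calc ∑ x ∈ T, (√(u + v * φ x))⁻¹
      = ∑ j ∈ T.image (fun x => (φ x - φ x₀).toNat), (√(u + v * φ x₀ + v * j))⁻¹ := by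
        rw [Finset.sum_image]
        · refine Finset.sum_congr rfl fun x hx => ?_
          have : (((φ x - φ x₀).toNat : ℕ) : ℝ) = φ x - φ x₀ := by
            have : (((φ x - φ x₀).toNat : ℕ) : ℤ) = φ x - φ x₀ :=
              Int.toNat_of_nonneg (by have := hmin x hx; omega)
            exact_mod_cast this
          rw [this]
          congr 2
          ring
        · intro x hx y hy hxy
          apply hφ hx hy
          have h2 := hmin x hx
          have h3 := hmin y hy
          simp only at hxy
          omega
    _ ≤ ∑ j ∈ Finset.range (m + 1), (√(u + v * φ x₀ + v * j))⁻¹ := by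
        apply Finset.sum_le_sum_of_subset_of_nonneg
        · intro j hj
          obtain ⟨x, hx, rfl⟩ := Finset.mem_image.mp hj
          have := hmax x hx
          have := hmin x hx
          rw [Finset.mem_range]
          omega
        · intros; positivity
    _ ≤ 1 + 2 * √(u + v * φ x₀ + v * m) / v := sum_range_inv_sqrt_le (h1 x₀ hx₀) hv m
    _ ≤ 1 + 2 * √M / v := by
        have : u + v * φ x₀ + v * m ≤ M := by
          rw [hm]
          linarith [hM x₁ hx₁]
        gcongr

/-- Sum of inverse square roots along an arithmetic progression with values in `[1, M]`. -/
lemma sum_inv_sqrt_affine_le {ι : Type*} (T : Finset ι) (φ : ι → ℤ)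
    (hφ : Set.InjOn φ T) {u v M : ℝ} (hv : v ≠ 0)
    (h1 : ∀ x ∈ T, 1 ≤ u + v * φ x) (hM : ∀ x ∈ T, u + v * φ x ≤ M) :
    ∑ x ∈ T, (√(u + v * φ x))⁻¹ ≤ 1 + 2 * √M / |v| := by
  rcases hv.lt_or_gt with hneg | hpos
  · have h := sum_inv_sqrt_affine_le_of_pos T (fun x => -φ x)
      (fun x hx y hy hxy => hφ hx hy (neg_injective hxy)) (u := u) (v := -v) (M := M)
      (by linarith)
    simp only [Int.cast_neg, neg_mul_neg] at h
    rw [abs_of_neg hneg]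
    exact h h1 hM
  · rw [abs_of_pos hpos]
    exact sum_inv_sqrt_affine_le_of_pos T φ hφ hpos h1 hM

lemma sum_inv_sqrt_one_add_abs_le (I : Finset ℤ) (c : ℤ) {R : ℝ} (hR : 1 ≤ R)
    (hI : ∀ a ∈ I, |2 * (a : ℝ) - c| ≤ 5 * R) :
    ∑ a ∈ I, (√(1 + |2 * (a : ℝ) - c|))⁻¹ ≤ 7 * √R := by
  rw [← Finset.sum_filter_add_sum_filter_not I (fun a => 0 ≤ 2 * (a : ℝ) - c)]
  have hpos : ∑ a ∈ I.filter (fun a : ℤ => 0 ≤ 2 * (a : ℝ) - c), (√(1 + |2 * (a : ℝ) - c|))⁻¹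
      ≤ 1 + 2 * √(6 * R) / |2| := by
    have h := sum_inv_sqrt_affine_le (I.filter (fun a : ℤ => 0 ≤ 2 * (a : ℝ) - c)) id
      (fun _ _ _ _ h => h) (u := 1 - c) (v := 2) (M := 6 * R) two_ne_zero ?_ ?_
    · refine le_trans (le_of_eq (Finset.sum_congr rfl fun a ha => ?_)) h
      rw [abs_of_nonneg (Finset.mem_filter.mp ha).2]
      congr 2
      simp only [id]
      ring
    · intro a ha
      have := (Finset.mem_filter.mp ha).2
      simp only [id]
      linarith
    · intro a ha
      have := (abs_le.mp (hI a (Finset.mem_filter.mp ha).1)).2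
      simp only [id]
      linarith
  have hneg : ∑ a ∈ I.filter (fun a : ℤ => ¬ 0 ≤ 2 * (a : ℝ) - c), (√(1 + |2 * (a : ℝ) - c|))⁻¹
      ≤ 1 + 2 * √(6 * R) / |-2| := by
    have h := sum_inv_sqrt_affine_le (I.filter (fun a : ℤ => ¬ 0 ≤ 2 * (a : ℝ) - c)) id
      (fun _ _ _ _ h => h) (u := 1 + c) (v := -2) (M := 6 * R) (by norm_num) ?_ ?_
    · refine le_trans (le_of_eq (Finset.sum_congr rfl fun a ha => ?_)) h
      rw [abs_of_neg (not_le.mp (Finset.mem_filter.mp ha).2)]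
      congr 2
      simp only [id]
      ring
    · intro a ha
      have := not_le.mp (Finset.mem_filter.mp ha).2
      simp only [id]
      linarith
    · intro a ha
      have := (abs_le.mp (hI a (Finset.mem_filter.mp ha).1)).1
      simp only [id]
      linarith
  have h6 : √(6 * R) ≤ 5 / 2 * √R := by
    rw [Real.sqrt_mul (by norm_num)]
    gcongr
    rw [Real.sqrt_le_left (by norm_num)]
    norm_num
  have hR1 : 1 ≤ √R := Real.one_le_sqrt.mpr hR
  rw [abs_neg] at hneg
  rw [abs_of_pos (by norm_num : (0 : ℝ) < 2)] at hpos hneg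
  linarith

lemma exists_dominant_coord (k : Fin 3 → ℤ) :
    ∃ i j l : Fin 3, znorm k ^ 2 ≤ 3 * (k i : ℝ) ^ 2 ∧ (∀ x, x = i ∨ x = j ∨ x = l) ∧
      ∀ f : Fin 3 → ℝ, ∑ x, f x = f i + f j + f l := by
  obtain ⟨i, -, hi⟩ := Finset.univ.exists_max_image (fun i => (k i : ℝ) ^ 2) Finset.univ_nonempty
  have hdom : znorm k ^ 2 ≤ 3 * (k i : ℝ) ^ 2 := by
    rw [znorm_sq]
    refine (Finset.sum_le_card_nsmul _ _ _ hi).trans_eq ?_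
    simp
  have hsum (f : Fin 3 → ℝ) := Fin.sum_univ_three f
  fin_cases i
  · exact ⟨0, 1, 2, hdom, by decide, hsum⟩
  · exact ⟨1, 0, 2, hdom, by decide, fun f => by rw [hsum]; ring⟩
  · exact ⟨2, 0, 1, hdom, by decide, fun f => by rw [hsum]; ring⟩

lemma inv_le_mul_inv_sqrt {n y z : ℝ} (hn : 1 ≤ n) (hyz : y ^ 2 + z ^ 2 ≤ 2 * n) :
    n⁻¹ ≤ 3 * ((√n)⁻¹ * ((√(1 + |y|))⁻¹ * (√(1 + |z|))⁻¹)) := by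
  have hle : (1 + |y|) * (1 + |z|) ≤ 3 ^ 2 * n := by
    nlinarith [sq_nonneg (|y| - |z|), sq_nonneg (|y| - 1), sq_nonneg (|z| - 1), sq_abs y, sq_abs z]
  have h1 : √(1 + |y|) * √(1 + |z|) ≤ 3 * √n := by
    rw [← Real.sqrt_mul (by positivity)]
    refine (Real.sqrt_le_sqrt hle).trans_eq ?_
    rw [Real.sqrt_mul (by positivity), Real.sqrt_sq (by norm_num)]
  have hn0 : 0 < √n := Real.sqrt_pos.mpr (by linarith)
  have hy0 : 0 < √(1 + |y|) := Real.sqrt_pos.mpr (by positivity)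
  have hz0 : 0 < √(1 + |z|) := Real.sqrt_pos.mpr (by positivity)
  have h2 : n = √n * √n := (Real.mul_self_sqrt (by linarith)).symm
  have h3 : (√n)⁻¹ ≤ 3 * ((√(1 + |y|))⁻¹ * (√(1 + |z|))⁻¹) := by
    rw [← mul_inv, ← div_eq_mul_inv, inv_eq_one_div, div_le_div_iff₀ hn0 (by positivity)]
    linarith
  calc n⁻¹ = (√n)⁻¹ * (√n)⁻¹ := by rw [← mul_inv, ← h2]
    _ ≤ (√n)⁻¹ * (3 * ((√(1 + |y|))⁻¹ * (√(1 + |z|))⁻¹)) := by gcongr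
    _ = _ := by ring

/-- The resolvent sum is `O(k_F)` when `2 k_F ≤ |k| ≤ 3 k_F`. -/
lemma sum_inv_gap_le_near {kF : ℝ} (hkF : 1 ≤ kF) {k : Fin 3 → ℤ} (hk : 2 * kF ≤ znorm k)
    (hk3 : znorm k ≤ 3 * kF) (T : Finset (Fin 3 → ℤ)) (hT : ∀ p ∈ T, p ∈ lune kF k) :
    ∑ p ∈ T, (znorm p ^ 2 - znorm (p - k) ^ 2)⁻¹ ≤ 735 * kF := by
  obtain ⟨i, j, l, hdom, hcov, hsum⟩ := exists_dominant_coord k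
  have hki : kF ≤ |(k i : ℝ)| := by
    refine le_of_abs_le (sq_le_sq.mp ?_)
    nlinarith
  have hgapM : ∀ p ∈ T, znorm p ^ 2 - znorm (p - k) ^ 2 ≤ 15 * kF ^ 2 := by
    intro p hp
    have h1 := (abs_le.mp (abs_inner_le k (p - k))).2
    have h2 := (hT p hp).2
    rw [gap_eq_inner]
    nlinarith [mul_le_mul hk3 h2 (znorm_nonneg _) (by linarith), znorm_nonneg k]
  have hcoord : ∀ x, ∀ p ∈ T, |2 * (p x : ℝ) - k x| ≤ 5 * kF := by
    intro x p hp
    have h1 := abs_le.mp (abs_coord_le_znorm k x)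
    have h2 := abs_le.mp (abs_coord_le_znorm (p - k) x)
    have h3 := (hT p hp).2
    simp only [Pi.sub_apply, Int.cast_sub] at h2
    rw [abs_le]
    constructor <;> linarith
  set g : Fin 3 → ℤ → ℝ := fun x a => (√(1 + |2 * (a : ℝ) - k x|))⁻¹
  have hg0 : ∀ x a, 0 ≤ g x a := fun x a => by positivity
  have hgsum : ∀ x, ∑ a ∈ T.image (fun p => p x), g x a ≤ 7 * √kF := by
    intro x
    apply sum_inv_sqrt_one_add_abs_le _ (k x) hkF
    intro a ha
    obtain ⟨p, hp, rfl⟩ := Finset.mem_image.mp ha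
    exact hcoord x p hp
  have hfiber : ∀ a b : ℤ, ∑ p ∈ T with (p j, p l) = (a, b),
      (√(znorm p ^ 2 - znorm (p - k) ^ 2))⁻¹ ≤ 5 := by
    intro a b
    set u : ℝ := k j * (2 * a - k j) + k l * (2 * b - k l) - k i ^ 2
    have hgap : ∀ p ∈ T.filter (fun p => (p j, p l) = (a, b)),
        znorm p ^ 2 - znorm (p - k) ^ 2 = u + 2 * k i * (p i : ℤ) := by
      intro p hp
      obtain ⟨h1, h2⟩ := Prod.mk.inj (Finset.mem_filter.mp hp).2
      rw [gap_eq, hsum, h1, h2]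
      ring
    have hki0 : (k i : ℝ) ≠ 0 := abs_pos.mp (by linarith)
    have h := sum_inv_sqrt_affine_le (T.filter (fun p => (p j, p l) = (a, b))) (fun p => p i)
      ?_ (u := u) (v := 2 * k i) (M := 15 * kF ^ 2) (by simpa using hki0) ?_ ?_
    · rw [Finset.sum_congr rfl fun p hp => by rw [hgap p hp]]
      refine h.trans ?_
      have h15 : √(15 * kF ^ 2) ≤ 4 * kF := by
        rw [Real.sqrt_le_left (by linarith)]
        nlinarith
      have : 2 * √(15 * kF ^ 2) / |2 * (k i : ℝ)| ≤ 4 := by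
        rw [abs_mul, abs_two, div_le_iff₀ (by positivity)]
        linarith
      linarith
    · intro p hp q hq hpq
      obtain ⟨h1, h2⟩ := Prod.mk.inj (Finset.mem_filter.mp hp).2
      obtain ⟨h3, h4⟩ := Prod.mk.inj (Finset.mem_filter.mp hq).2
      funext x
      rcases hcov x with rfl | rfl | rfl
      · exact hpq
      · rw [h1, h3]
      · rw [h2, h4]
    · intro p hp
      rw [← hgap p hp]
      exact one_le_gap (hT p (Finset.mem_filter.mp hp).1)
    · intro p hp
      rw [← hgap p hp]
      exact hgapM p (Finset.mem_filter.mp hp).1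
  calc ∑ p ∈ T, (znorm p ^ 2 - znorm (p - k) ^ 2)⁻¹
      ≤ ∑ p ∈ T, 3 * ((√(znorm p ^ 2 - znorm (p - k) ^ 2))⁻¹ * (g j (p j) * g l (p l))) := by
        refine Finset.sum_le_sum fun p hp => ?_
        apply inv_le_mul_inv_sqrt (one_le_gap (hT p hp))
        have := sum_sq_le_gap (hT p hp) hk
        rw [hsum] at this
        linarith [sq_nonneg (2 * (p i : ℝ) - k i)]
    _ = 3 * ∑ ab ∈ T.image (fun p => p j) ×ˢ T.image (fun p => p l),
          ∑ p ∈ T with (p j, p l) = ab,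
            (√(znorm p ^ 2 - znorm (p - k) ^ 2))⁻¹ * (g j (p j) * g l (p l)) := by
        rw [← Finset.mul_sum, Finset.sum_fiberwise_of_maps_to]
        intro p hp
        exact Finset.mem_product.mpr
          ⟨Finset.mem_image_of_mem _ hp, Finset.mem_image_of_mem _ hp⟩
    _ ≤ 3 * ∑ ab ∈ T.image (fun p => p j) ×ˢ T.image (fun p => p l),
          5 * (g j ab.1 * g l ab.2) := by
        gcongr with ab hab
        rw [Finset.sum_congr rfl (g := fun p =>
          (√(znorm p ^ 2 - znorm (p - k) ^ 2))⁻¹ * (g j ab.1 * g l ab.2)) fun p hp => by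
            rw [← (Finset.mem_filter.mp hp).2], ← Finset.sum_mul]
        exact mul_le_mul_of_nonneg_right (hfiber ab.1 ab.2) (mul_nonneg (hg0 _ _) (hg0 _ _))
    _ = 15 * ((∑ a ∈ T.image (fun p => p j), g j a) * ∑ b ∈ T.image (fun p => p l), g l b) := by
        rw [← Finset.mul_sum, Finset.sum_mul_sum, Finset.sum_product]
        ring
    _ ≤ 15 * ((7 * √kF) * (7 * √kF)) := by
        gcongr
        · exact hgsum j
        · exact hgsum l
    _ = 735 * kF := by
        have := Real.mul_self_sqrt (by linarith : 0 ≤ kF)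
        linear_combination 735 * this

lemma card_le_of_subset_lune {kF : ℝ} (hkF : 1 ≤ kF) {k : Fin 3 → ℤ}
    (T : Finset (Fin 3 → ℤ)) (hT : ∀ p ∈ T, p ∈ lune kF k) : (T.card : ℝ) ≤ 27 * kF ^ 3 := by
  set m := ⌊kF⌋
  have hm0 : 0 ≤ m := Int.floor_nonneg.mpr (by linarith)
  have hsub : T ⊆ Fintype.piFinset fun x => Finset.Icc (k x - m) (k x + m) := by
    intro p hp
    rw [Fintype.mem_piFinset]
    intro x
    have h2 := (abs_coord_le_znorm (p - k) x).trans (hT p hp).2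
    rw [← Int.cast_abs] at h2
    have h3 := abs_le.mp (Int.le_floor.mpr h2)
    simp only [Pi.sub_apply] at h3
    rw [Finset.mem_Icc]
    constructor <;> linarith
  have hcard := Finset.card_le_card hsub
  rw [Fintype.card_piFinset] at hcard
  have hside (x : Fin 3) : (Finset.Icc (k x - m) (k x + m)).card = (2 * m + 1).toNat := by
    rw [Int.card_Icc]
    congr 1
    ring
  simp only [hside, Finset.prod_const, Finset.card_univ, Fintype.card_fin] at hcard
  have hcast : (((2 * m + 1).toNat : ℕ) : ℝ) = 2 * m + 1 := by
    have : (((2 * m + 1).toNat : ℕ) : ℤ) = 2 * m + 1 := Int.toNat_of_nonneg (by omega)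
    exact_mod_cast this
  have hle : (2 * (m : ℝ) + 1) ≤ 3 * kF := by linarith [Int.floor_le kF]
  have hm0' : (0 : ℝ) ≤ m := by exact_mod_cast hm0
  calc (T.card : ℝ) ≤ (((2 * m + 1).toNat ^ 3 : ℕ) : ℝ) := by exact_mod_cast hcard
    _ = (2 * (m : ℝ) + 1) ^ 3 := by rw [Nat.cast_pow, hcast]
    _ ≤ (3 * kF) ^ 3 := by gcongr
    _ = 27 * kF ^ 3 := by ring

lemma sum_inv_gap_le_far {kF : ℝ} (hkF : 1 ≤ kF) {k : Fin 3 → ℤ} (hk3 : 3 * kF ≤ znorm k)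
    (T : Finset (Fin 3 → ℤ)) (hT : ∀ p ∈ T, p ∈ lune kF k) :
    ∑ p ∈ T, (znorm p ^ 2 - znorm (p - k) ^ 2)⁻¹ ≤ 81 * kF ^ 3 * (znorm k ^ 2)⁻¹ := by
  have hk0 : 0 < znorm k := by linarith
  have hterm : ∀ p ∈ T, (znorm p ^ 2 - znorm (p - k) ^ 2)⁻¹ ≤ 3 * (znorm k ^ 2)⁻¹ := by
    intro p hp
    have h1 := (abs_le.mp (abs_inner_le k (p - k))).1
    have h2 : znorm (p - k) ≤ znorm k / 3 := by linarith [(hT p hp).2]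
    have h3 : znorm k ^ 2 / 3 ≤ znorm p ^ 2 - znorm (p - k) ^ 2 := by
      rw [gap_eq_inner]
      nlinarith [mul_le_mul_of_nonneg_left h2 hk0.le]
    refine (inv_anti₀ (by positivity) h3).trans_eq ?_
    rw [inv_div, div_eq_mul_inv]
  refine (Finset.sum_le_card_nsmul _ _ _ hterm).trans ?_
  rw [nsmul_eq_mul]
  calc (T.card : ℝ) * (3 * (znorm k ^ 2)⁻¹) ≤ 27 * kF ^ 3 * (3 * (znorm k ^ 2)⁻¹) := by
        gcongr
        exact card_le_of_subset_lune hkF T hT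
    _ = _ := by ring

/-- There is `C > 0` such that for every `k_F ≥ 1` and every
`k ∈ ℤ³` with `|k| ≥ 2k_F`, `D₁(k, k_F) ≤ C k_F³ |k|^{−2}`. -/
theorem D1_large_k_bound :
    ∃ C : ℝ, 0 < C ∧ ∀ kF : ℝ, 1 ≤ kF → ∀ k : Fin 3 → ℤ,
      2 * kF ≤ znorm k →
      Dsum 1 kF k ≤ C * kF ^ 3 * (znorm k) ^ (-(2 : ℝ)) := by
  classical
  refine ⟨6615, by norm_num, fun kF hkF k hk => ?_⟩
  have hk0 : 0 < znorm k := by linarith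
  rw [Real.rpow_neg hk0.le, Real.rpow_two]
  have hterm (p : Fin 3 → ℤ) (hp : p ∈ lune kF k) :
      0 ≤ (znorm p ^ 2 - znorm (p - k) ^ 2)⁻¹ := by
    have := one_le_gap hp
    positivity
  simp only [Dsum, Real.rpow_neg_one]
  refine Real.tsum_le_of_sum_le (fun p => ?_) fun S => ?_
  · split_ifs with hp
    exacts [hterm p hp, le_rfl]
  rw [← Finset.sum_filter]
  have hT : ∀ p ∈ S.filter (· ∈ lune kF k), p ∈ lune kF k := fun p hp =>
    (Finset.mem_filter.mp hp).2
  rcases le_total (znorm k) (3 * kF) with h3 | h3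
  · refine (sum_inv_gap_le_near hkF hk h3 _ hT).trans ?_
    rw [← div_eq_mul_inv, le_div_iff₀ (by positivity)]
    have : znorm k ^ 2 ≤ 9 * kF ^ 2 := by nlinarith
    nlinarith [mul_le_mul_of_nonneg_left this (by linarith : 0 ≤ kF)]
  · refine (sum_inv_gap_le_far hkF h3 _ hT).trans ?_
    gcongr
    norm_num
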